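/- Let μ be a Borel probability measure on a compact interval 𝕀 ⊂ ℝ of positive length, and n ∈ ℕ. (i) For every x ∈ Ξ_n there exists a best d_1-approximation of μ given x, and d_1(μ, δ_x^p) = min_{q∈Π_n} d_1(μ, δ_x^q) if and only if for every j = 0,…,n with x_j < x_{j+1}: F_{μ−}((x_j + x_{j+1})/2) ≤ P_j ≤ F_μ((x_j + x_{j+1})/2). (ii) For every p ∈ Π_n there exists a best d_1-approximation of μ given p, and d_1(μ, δ_x^p) = min_{y∈Ξ_n} d_1(μ, δ_y^p) if and only if for every j = 1,…,n with P_{j−1} < P_j: F⁻¹_{μ−}((P_{j−1} + P_j)/2) ≤ x_j ≤ F_μ⁻¹((P_{j−1} + P_j)/2). (iii) There exists a best d_1-approximation of μ with at most n atoms, and if d_1(μ, δ_x^p) = min_{y∈Ξ_n, q∈Π_n} d_1(μ, δ_y^q), then the inequalities in (i) and (ii) hold for every j = 1,…,n. -/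

import Mathlib

open MeasureTheory Filter Set

noncomputable section

namespace BenfordApprox

/-- Right-hand limit `f₊` of a nondecreasing `f : ℝ → ℝ̄`, at an extended-real point. -/
def fplus (f : ℝ → EReal) (a : EReal) : EReal := sInf (f '' {x : ℝ | a < (x : EReal)})

/-- Left-hand limit `f₋` of a nondecreasing `f : ℝ → ℝ̄`, at an extended-real point. -/
def fminus (f : ℝ → EReal) (a : EReal) : EReal := sSup (f '' {x : ℝ | (x : EReal) < a})

/-- The (upper) inverse function `f⁻¹(t) = sup {x : f x ≤ t}` (with `sup ∅ = ⊥`). -/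
def upperInv (f : ℝ → EReal) (t : ℝ) : EReal :=
  sSup ((fun x : ℝ => (x : EReal)) '' {x : ℝ | f x ≤ (t : EReal)})

/-- The upper inverse, for an extended-real argument. -/
def upperInvE (f : ℝ → EReal) (t : EReal) : EReal :=
  sSup ((fun x : ℝ => (x : EReal)) '' {x : ℝ | f x ≤ t})

/-- Lévy-type distance `d_L(f,g)` between nondecreasing functions `f g : ℝ → ℝ̄`. -/
def dLfun (f g : ℝ → EReal) : EReal :=
  sInf ((fun y : ℝ => (y : EReal)) ''
    {y : ℝ | 0 ≤ y ∧ ∀ x : ℝ, f (x - y) - (y : EReal) ≤ g x ∧ g x ≤ f (x + y) + (y : EReal)})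

/-- The auxiliary function `ℓ_{f,I}`; it depends on `I` only through `lo = inf I`, `hi = sup I`. -/
def ell (f : ℝ → EReal) (lo hi : EReal) (x : ℝ) : ℝ :=
  sInf {y : ℝ | 0 ≤ y ∧ fminus f (hi - (y : EReal)) - (y : EReal) ≤ (x : EReal) ∧
    (x : EReal) ≤ fplus f (lo + (y : EReal)) + (y : EReal)}

/-- The minimal value `ℓ*_{f,I} = min {y ≥ 0 : f₋(sup I − y) − y ≤ f₊(inf I + y) + y}`. -/
def ellStar (f : ℝ → EReal) (lo hi : EReal) : ℝ :=
  sInf {y : ℝ | 0 ≤ y ∧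
    fminus f (hi - (y : EReal)) - (y : EReal) ≤ fplus f (lo + (y : EReal)) + (y : EReal)}

/-- Distribution function `F_μ(t) = μ {y ∈ 𝕀 : y ≤ t}` of `μ`, where `𝕀 = [A,B]`. -/
def cdf (μ : Measure ℝ) (A B : ℝ) (t : ℝ) : ℝ := (μ (Icc A B ∩ Iic t)).toReal

/-- `F_μ` evaluated at an extended-real point (so `F_μ(−∞) = 0`, `F_μ(+∞) = 1`). -/
def cdfE (μ : Measure ℝ) (A B : ℝ) (a : EReal) : ℝ :=
  (μ (Icc A B ∩ {y : ℝ | (y : EReal) ≤ a})).toReal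

/-- Left limit `F_{μ−}` at an extended-real point (so `F_{μ−}(−∞) = 0`, `F_{μ−}(+∞) = 1`). -/
def cdfL (μ : Measure ℝ) (A B : ℝ) (a : EReal) : ℝ :=
  sSup ((cdf μ A B) '' {t : ℝ | (t : EReal) < a})

/-- Left limit `F_{μ−}` at a real point. -/
def cdfm (μ : Measure ℝ) (A B : ℝ) (t : ℝ) : ℝ := sSup ((cdf μ A B) '' Iio t)

/-- The (upper) quantile function `F_μ⁻¹` of `μ` on `𝕀 = [A,B]`, extended monotonically to `ℝ`. -/
def quant (μ : Measure ℝ) (A B : ℝ) (t : ℝ) : ℝ :=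
  if t < (μ {A}).toReal ∨ t < 0 then A
  else sSup {y ∈ Icc A B | cdf μ A B y ≤ t}

/-- Left limit `F⁻¹_{μ−}` of the quantile function. -/
def quantm (μ : Measure ℝ) (A B : ℝ) (t : ℝ) : ℝ := sSup ((quant μ A B) '' Iio t)

/-- `F_μ` as a function into the extended reals. -/
def cdfEReal (μ : Measure ℝ) (A B : ℝ) : ℝ → EReal := fun t => ((cdf μ A B t : ℝ) : EReal)

/-- `F_μ⁻¹` as a function into the extended reals. -/
def quantEReal (μ : Measure ℝ) (A B : ℝ) : ℝ → EReal := fun t => ((quant μ A B t : ℝ) : EReal)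

/-- The finitely supported measure `δ_x^p = Σ_j p_j δ_{x_j}`. -/
def discr (n : ℕ) (x p : Fin n → ℝ) : Measure ℝ :=
  ∑ j : Fin n, ENNReal.ofReal (p j) • Measure.dirac (x j)

/-- `p ∈ Π_n`: a probability vector. -/
def IsPi (n : ℕ) (p : Fin n → ℝ) : Prop := (∀ j, 0 ≤ p j) ∧ ∑ j, p j = 1

/-- `x ∈ Ξ_n`: a nondecreasing vector of locations in `𝕀 = [A,B]`. -/
def IsXi (A B : ℝ) (n : ℕ) (x : Fin n → ℝ) : Prop := (∀ j, x j ∈ Icc A B) ∧ Monotone x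

/-- The uniform weight vector `u_n = (1/n, …, 1/n)`. -/
def unif (n : ℕ) : Fin n → ℝ := fun _ => 1 / (n : ℝ)

/-- Partial sums `P_i = Σ_{j<i} p_j` (so `P_0 = 0`, `P_n = 1`). -/
def psum (n : ℕ) (p : Fin n → ℝ) (i : ℕ) : ℝ := ∑ j : Fin n, if (j : ℕ) < i then p j else 0

/-- Locations extended by `x_0 = −∞`, `x_{n+1} = +∞`; here `extPts n x j` is the paper's `x_j`. -/
def extPts (n : ℕ) (x : Fin n → ℝ) : ℕ → EReal := fun j =>
  if hj : j = 0 then ⊥ else if h : j ≤ n then ((x ⟨j - 1, by omega⟩ : ℝ) : EReal) else ⊤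

/-- `xcoord n x j` is the paper's `x_{j+1}` (0-based access). -/
def xcoord (n : ℕ) (x : Fin n → ℝ) (j : ℕ) : ℝ := if h : j < n then x ⟨j, h⟩ else 0

/-- The normalizing constant `ω = max{1, λ(𝕀)}/λ(𝕀)` for `𝕀 = [A,B]`. -/
def omegaI (A B : ℝ) : ℝ := max 1 (B - A) / (B - A)

/-- Lévy distance between Borel measures on `𝕀 = [A,B]`. -/
def dLevy (A B : ℝ) (μ ν : Measure ℝ) : ℝ :=
  omegaI A B * sInf {y : ℝ | 0 ≤ y ∧
    ∀ t : ℝ, cdf μ A B (t - y) - y ≤ cdf ν A B t ∧ cdf ν A B t ≤ cdf μ A B (t + y) + y}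

/-- Kolmogorov (uniform) distance between Borel measures on `𝕀 = [A,B]`. -/
def dKol (A B : ℝ) (μ ν : Measure ℝ) : ℝ :=
  sSup (Set.range fun t : ℝ => |cdf μ A B t - cdf ν A B t|)

/-- `L¹`-Kantorovich distance between Borel measures on `𝕀 = [A,B]`. -/
def dKant1 (A B : ℝ) (μ ν : Measure ℝ) : ℝ :=
  (B - A)⁻¹ * ∫ y in Ioo (0 : ℝ) 1, |quant μ A B y - quant ν A B y|

/-- `L^r`-Kantorovich distance between Borel measures on `𝕀 = [A,B]`. -/
def dKant (A B r : ℝ) (μ ν : Measure ℝ) : ℝ :=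
  (B - A)⁻¹ * (∫ y in Ioo (0 : ℝ) 1, |quant μ A B y - quant ν A B y| ^ r) ^ (1 / r)

/-- The Benford measure `β_b` on `[1,b]`: the law of `b^U` with `U` uniform on `[0,1)`. -/
def benford (b : ℝ) : Measure ℝ := (volume.restrict (Ico (0 : ℝ) 1)).map (fun t : ℝ => b ^ t)

/-- The map `T_{f,a}(x) = f₊(f⁻¹(x+a) + 2a) + a`. -/
def Tmap (f : ℝ → EReal) (a : ℝ) : EReal → EReal :=
  fun x => fplus f (upperInvE f (x + (a : EReal)) + ((2 * a : ℝ) : EReal)) + (a : EReal)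

/-- The map `S_{f,a}(x) = f₊(f⁻¹(x+a)) + a`. -/
def Smap (f : ℝ → EReal) (a : ℝ) : EReal → EReal :=
  fun x => fplus f (upperInvE f (x + (a : EReal))) + (a : EReal)

/-- `L_•^{•,n} = min {a ≥ 0 : T_{F_μ,a}^{[n]}(0) ≥ 1}`. -/
def LBB (μ : Measure ℝ) (A B : ℝ) (n : ℕ) : ℝ :=
  sInf {a : ℝ | 0 ≤ a ∧ (1 : EReal) ≤ (Tmap (cdfEReal μ A B) a)^[n] ((0 : ℝ) : EReal)}

/-- `K_•^{•,n} = min {a ≥ 0 : S_{F_μ,a}^{[n]}(0) ≥ 1}`. -/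
def KBB (μ : Measure ℝ) (A B : ℝ) (n : ℕ) : ℝ :=
  sInf {a : ℝ | 0 ≤ a ∧ (1 : EReal) ≤ (Smap (cdfEReal μ A B) a)^[n] ((0 : ℝ) : EReal)}


/-! ### Approximation of monotone functions by constants -/

/-- The constant `c` is a median of the nondecreasing function `G` on the interval `[a,b]`. -/
def IsMed (G : ℝ → ℝ) (a b c : ℝ) : Prop :=
  (∀ s < (a + b) / 2, G s ≤ c) ∧ ∀ s > (a + b) / 2, c ≤ G s

theorem intervalIntegrable_abs_sub {G : ℝ → ℝ} (hG : Monotone G) (a b c : ℝ) :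
    IntervalIntegrable (fun s => |G s - c|) volume a b :=
  (hG.intervalIntegrable.sub intervalIntegrable_const).abs

/-- The part of `∫ |G - c|` over `[a,b]` that depends on `c`. -/
def medExcess (G : ℝ → ℝ) (a b c : ℝ) : ℝ :=
  (∫ s in a..(a + b) / 2, (|G s - c| - (c - G s))) +
    ∫ s in (a + b) / 2..b, (|G s - c| - (G s - c))

theorem integral_abs_sub_eq_add_medExcess {G : ℝ → ℝ} (hG : Monotone G) (a b c : ℝ) :
    ∫ s in a..b, |G s - c| =
      ((∫ s in (a + b) / 2..b, G s) - ∫ s in a..(a + b) / 2, G s) + medExcess G a b c := by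
  have hi := fun u v => intervalIntegrable_abs_sub hG u v c
  have hg := fun u v => (hG.intervalIntegrable : IntervalIntegrable G volume u v)
  have hc := fun u v => (intervalIntegrable_const : IntervalIntegrable (fun _ => c) volume u v)
  rw [medExcess, ← intervalIntegral.integral_add_adjacent_intervals (hi a ((a + b) / 2)) (hi _ b),
    intervalIntegral.integral_sub (hi _ _) ((hc _ _).sub (hg _ _)),
    intervalIntegral.integral_sub (hi _ _) ((hg _ _).sub (hc _ _)),
    intervalIntegral.integral_sub (hc _ _) (hg _ _),
    intervalIntegral.integral_sub (hg _ _) (hc _ _)]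
  simp only [intervalIntegral.integral_const, smul_eq_mul]
  ring

theorem medExcess_nonneg (G : ℝ → ℝ) {a b : ℝ} (hab : a ≤ b) (c : ℝ) :
    0 ≤ medExcess G a b c := by
  refine add_nonneg (intervalIntegral.integral_nonneg (by linarith) fun s _ => ?_)
    (intervalIntegral.integral_nonneg (by linarith) fun s _ => ?_)
  · linarith [neg_abs_le (G s - c)]
  · linarith [le_abs_self (G s - c)]

theorem IsMed.medExcess_eq_zero {G : ℝ → ℝ} {a b c : ℝ} (hab : a ≤ b) (h : IsMed G a b c) :
    medExcess G a b c = 0 := by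
  have hae : ∀ᵐ s : ℝ, s ≠ (a + b) / 2 := by simp [ae_iff]
  rw [medExcess, intervalIntegral.integral_zero_ae, intervalIntegral.integral_zero_ae, add_zero]
  · filter_upwards [hae] with s hs hm
    rw [uIoc_of_le (by linarith)] at hm
    have := h.2 s hm.1
    rw [abs_of_nonneg (by linarith)]; ring
  · filter_upwards [hae] with s hs hm
    rw [uIoc_of_le (by linarith)] at hm
    have := h.1 s (lt_of_le_of_ne hm.2 hs)
    rw [abs_of_nonpos (by linarith)]; ring

theorem isMed_of_medExcess_le_zero {G : ℝ → ℝ} (hG : Monotone G) {a b c : ℝ} (hab : a < b)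
    (h : medExcess G a b c ≤ 0) : IsMed G a b c := by
  have hi := fun u v => intervalIntegrable_abs_sub hG u v c
  have hg := fun u v => (hG.intervalIntegrable : IntervalIntegrable G volume u v)
  have hc := fun u v => (intervalIntegrable_const : IntervalIntegrable (fun _ => c) volume u v)
  have h1 : ∀ s, 0 ≤ |G s - c| - (c - G s) := fun s => by linarith [neg_abs_le (G s - c)]
  have h2 : ∀ s, 0 ≤ |G s - c| - (G s - c) := fun s => by linarith [le_abs_self (G s - c)]
  have n1 := intervalIntegral.integral_nonneg (μ := volume) (a := a) (b := (a + b) / 2)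
    (by linarith) fun s _ => h1 s
  have n2 := intervalIntegral.integral_nonneg (μ := volume) (a := (a + b) / 2) (b := b)
    (by linarith) fun s _ => h2 s
  rw [medExcess] at h
  constructor
  · intro s hs
    by_contra! hlt
    have hms : max a s < (a + b) / 2 := max_lt (by linarith) hs
    have hp : 0 < ∫ t in max a s..(a + b) / 2, (|G t - c| - (c - G t)) := by
      refine intervalIntegral.intervalIntegral_pos_of_pos_on ((hi _ _).sub ((hc _ _).sub (hg _ _)))
        (fun t ht => ?_) hms
      have := hG ((le_max_right a s).trans ht.1.le)
      rw [abs_of_pos (by linarith)]; linarith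
    have hsplit := intervalIntegral.integral_add_adjacent_intervals
      ((hi a (max a s)).sub ((hc _ _).sub (hg _ _)))
      ((hi (max a s) ((a + b) / 2)).sub ((hc _ _).sub (hg _ _)))
    have n3 := intervalIntegral.integral_nonneg (μ := volume) (le_max_left a s) fun s _ => h1 s
    linarith
  · intro s hs
    by_contra! hlt
    have hms : (a + b) / 2 < min b s := lt_min (by linarith) hs
    have hp : 0 < ∫ t in (a + b) / 2..min b s, (|G t - c| - (G t - c)) := by
      refine intervalIntegral.intervalIntegral_pos_of_pos_on ((hi _ _).sub ((hg _ _).sub (hc _ _)))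
        (fun t ht => ?_) hms
      have := hG (ht.2.le.trans (min_le_right b s))
      rw [abs_of_neg (by linarith)]; linarith
    have hsplit := intervalIntegral.integral_add_adjacent_intervals
      ((hi ((a + b) / 2) (min b s)).sub ((hg _ _).sub (hc _ _)))
      ((hi (min b s) b).sub ((hg _ _).sub (hc _ _)))
    have n3 := intervalIntegral.integral_nonneg (μ := volume) (min_le_left b s) fun s _ => h2 s
    linarith

/-- A median minimizes `c ↦ ∫ |G - c|`. -/
theorem IsMed.integral_le {G : ℝ → ℝ} (hG : Monotone G) {a b c : ℝ} (hab : a ≤ b)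
    (h : IsMed G a b c) (d : ℝ) :
    ∫ s in a..b, |G s - c| ≤ ∫ s in a..b, |G s - d| := by
  rw [integral_abs_sub_eq_add_medExcess hG, integral_abs_sub_eq_add_medExcess hG,
    h.medExcess_eq_zero hab]
  linarith [medExcess_nonneg G hab d]

/-- On a nondegenerate interval, only medians minimize `c ↦ ∫ |G - c|`. -/
theorem IsMed.of_integral_le {G : ℝ → ℝ} (hG : Monotone G) {a b c d : ℝ} (hab : a < b)
    (h : IsMed G a b c) (hd : ∫ s in a..b, |G s - d| ≤ ∫ s in a..b, |G s - c|) :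
    IsMed G a b d := by
  rw [integral_abs_sub_eq_add_medExcess hG, integral_abs_sub_eq_add_medExcess hG,
    h.medExcess_eq_zero hab.le] at hd
  exact isMed_of_medExcess_le_zero hG hab (by linarith)

/-! ### Distribution and quantile functions -/

theorem cdf_eq_stieltjes {A B : ℝ} {μ : Measure ℝ} [IsProbabilityMeasure μ]
    (hμ : μ (Icc A B) = 1) : cdf μ A B = ProbabilityTheory.cdf μ := by
  funext t
  rw [ProbabilityTheory.cdf_eq_real, cdf, Measure.real]
  congr 1
  have h : ∀ᵐ y ∂μ, y ∈ Icc A B := (prob_compl_eq_zero_iff measurableSet_Icc).2 hμ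
  refine measure_congr ?_
  filter_upwards [h] with y hy
  exact propext ⟨fun h => h.2, fun h => ⟨hy, h⟩⟩

theorem cdf_mono {A B : ℝ} {μ : Measure ℝ} [IsProbabilityMeasure μ] :
    Monotone (cdf μ A B) := fun s t hst =>
  ENNReal.toReal_mono (measure_ne_top _ _) (measure_mono (by gcongr))

theorem cdf_nonneg (μ : Measure ℝ) (A B t : ℝ) : 0 ≤ cdf μ A B t := ENNReal.toReal_nonneg

theorem cdf_le_one {A B : ℝ} {μ : Measure ℝ} [IsProbabilityMeasure μ] (t : ℝ) :
    cdf μ A B t ≤ 1 := measureReal_le_one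

theorem cdf_left {A B : ℝ} (hAB : A ≤ B) {μ : Measure ℝ} : cdf μ A B A = (μ {A}).toReal := by
  have : Icc A B ∩ Iic A = {A} := by
    ext y; simp only [mem_inter_iff, mem_Icc, mem_Iic, mem_singleton_iff]
    constructor
    · rintro ⟨⟨h, _⟩, h'⟩; linarith
    · rintro rfl; exact ⟨⟨le_rfl, hAB⟩, le_rfl⟩
  rw [cdf, this]

theorem le_cdf_iff_forall_gt {A B : ℝ} {μ : Measure ℝ} [IsProbabilityMeasure μ]
    (hμ : μ (Icc A B) = 1) {m c : ℝ} : c ≤ cdf μ A B m ↔ ∀ s > m, c ≤ cdf μ A B s := by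
  refine ⟨fun h s hs => h.trans (cdf_mono hs.le), fun h => ?_⟩
  rw [cdf_eq_stieltjes hμ] at h ⊢
  have ht : Tendsto (ProbabilityTheory.cdf μ) (nhdsWithin m (Ioi m))
      (nhds (ProbabilityTheory.cdf μ m)) :=
    ((ProbabilityTheory.cdf μ).right_continuous m).mono Ioi_subset_Ici_self
  exact ge_of_tendsto ht (eventually_nhdsWithin_of_forall h)

theorem quant_eq_sSup {A B : ℝ} (hAB : A ≤ B) {μ : Measure ℝ} {t : ℝ}
    (ht : cdf μ A B A ≤ t) : quant μ A B t = sSup {y ∈ Icc A B | cdf μ A B y ≤ t} := by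
  have h0 := (cdf_nonneg μ A B A).trans ht
  rw [cdf_left hAB] at ht
  rw [quant, if_neg]
  rintro (h | h) <;> linarith

theorem quant_eq_left {A B : ℝ} (hAB : A ≤ B) {μ : Measure ℝ} {t : ℝ}
    (ht : t < cdf μ A B A) : quant μ A B t = A := by
  rw [cdf_left hAB] at ht
  rw [quant, if_pos (Or.inl ht)]

theorem bddAbove_quant_set {A B : ℝ} {μ : Measure ℝ} {t : ℝ} :
    BddAbove {y ∈ Icc A B | cdf μ A B y ≤ t} := ⟨B, fun _ hy => hy.1.2⟩

theorem quant_mem {A B : ℝ} (hAB : A ≤ B) {μ : Measure ℝ} (t : ℝ) :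
    quant μ A B t ∈ Icc A B := by
  rcases lt_or_ge t (cdf μ A B A) with h | h
  · rw [quant_eq_left hAB h]; exact ⟨le_rfl, hAB⟩
  · rw [quant_eq_sSup hAB h]
    have hA : A ∈ {y ∈ Icc A B | cdf μ A B y ≤ t} := ⟨⟨le_rfl, hAB⟩, h⟩
    exact ⟨le_csSup bddAbove_quant_set hA, csSup_le ⟨A, hA⟩ fun y hy => hy.1.2⟩

theorem le_quant {A B : ℝ} {μ : Measure ℝ} [IsProbabilityMeasure μ] {s t : ℝ}
    (hs : s ∈ Icc A B) (h : cdf μ A B s ≤ t) : s ≤ quant μ A B t := by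
  rw [quant_eq_sSup (hs.1.trans hs.2) ((cdf_mono hs.1).trans h)]
  exact le_csSup bddAbove_quant_set ⟨hs, h⟩

theorem cdf_le_of_lt_quant {A B : ℝ} (hAB : A ≤ B) {μ : Measure ℝ} [IsProbabilityMeasure μ]
    {s t : ℝ} (hs : A ≤ s) (h : s < quant μ A B t) : cdf μ A B s ≤ t := by
  rcases lt_or_ge t (cdf μ A B A) with h' | h'
  · rw [quant_eq_left hAB h'] at h; linarith
  · rw [quant_eq_sSup hAB h'] at h
    have hA : A ∈ {y ∈ Icc A B | cdf μ A B y ≤ t} := ⟨⟨le_rfl, hAB⟩, h'⟩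
    obtain ⟨y, hy, hsy⟩ := exists_lt_of_lt_csSup ⟨A, hA⟩ h
    exact (cdf_mono hsy.le).trans hy.2

theorem quant_mono {A B : ℝ} (hAB : A ≤ B) {μ : Measure ℝ} [IsProbabilityMeasure μ] :
    Monotone (quant μ A B) := by
  intro s t hst
  rcases lt_or_ge s (cdf μ A B A) with h | h
  · rw [quant_eq_left hAB h]; exact (quant_mem hAB t).1
  · rw [quant_eq_sSup hAB h, quant_eq_sSup hAB (h.trans hst)]
    have hA : A ∈ {y ∈ Icc A B | cdf μ A B y ≤ s} := ⟨⟨le_rfl, hAB⟩, h⟩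
    refine csSup_le_csSup bddAbove_quant_set ⟨A, hA⟩ ?_
    exact fun y hy => ⟨hy.1, hy.2.trans hst⟩

theorem quant_eq_of_cdf {A B : ℝ} {μ : Measure ℝ} [IsProbabilityMeasure μ]
    {c t : ℝ} (hc : c ∈ Icc A B) (h1 : ∀ s < c, cdf μ A B s ≤ t) (h2 : t < cdf μ A B c) :
    quant μ A B t = c := by
  have hAB := hc.1.trans hc.2
  refine le_antisymm ?_ ?_ <;> by_contra! h
  · linarith [cdf_le_of_lt_quant hAB hc.1 h]
  · obtain ⟨z, hz1, hz2⟩ := exists_between h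
    have := le_quant ⟨(quant_mem hAB t).1.trans hz1.le, hz2.le.trans hc.2⟩ (h1 z hz2)
    linarith

theorem le_quant_iff_forall_gt {A B : ℝ} (hAB : A ≤ B) {μ : Measure ℝ} [IsProbabilityMeasure μ]
    {m c : ℝ} : c ≤ quant μ A B m ↔ ∀ s > m, c ≤ quant μ A B s := by
  refine ⟨fun h s hs => h.trans (quant_mono hAB hs.le), fun h => ?_⟩
  by_contra! hlt
  obtain ⟨z, hz1, hz2⟩ := exists_between hlt
  have hzA : A ≤ z := (quant_mem hAB m).1.trans hz1.le
  have hzB : z ≤ B := hz2.le.trans ((h (m + 1) (by linarith)).trans (quant_mem hAB _).2)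
  have hm : m < cdf μ A B z := by
    by_contra! hle
    linarith [le_quant ⟨hzA, hzB⟩ hle]
  obtain ⟨s, hs1, hs2⟩ := exists_between hm
  linarith [cdf_le_of_lt_quant hAB hzA (hz2.trans_le (h s hs1))]

theorem isMed_quant_iff {A B : ℝ} (hAB : A ≤ B) {μ : Measure ℝ} [IsProbabilityMeasure μ]
    {a b c : ℝ} : IsMed (quant μ A B) a b c ↔
      quantm μ A B ((a + b) / 2) ≤ c ∧ c ≤ quant μ A B ((a + b) / 2) := by
  rw [IsMed, le_quant_iff_forall_gt hAB, quantm, csSup_le_iff]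
  · simp only [forall_mem_image, mem_Iio]
  · exact ⟨B, by rintro _ ⟨s, _, rfl⟩; exact (quant_mem hAB s).2⟩
  · exact ⟨_, mem_image_of_mem _ (mem_Iio.2 (sub_one_lt _))⟩

theorem isMed_cdf_iff {A B : ℝ} {μ : Measure ℝ} [IsProbabilityMeasure μ]
    (hμ : μ (Icc A B) = 1) {a b c : ℝ} : IsMed (cdf μ A B) a b c ↔
      cdfL μ A B (((a : EReal) + b) / 2) ≤ c ∧ c ≤ cdfE μ A B (((a : EReal) + b) / 2) := by
  have hm : ((a : EReal) + b) / 2 = (((a + b) / 2 : ℝ) : EReal) := by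
    rw [EReal.coe_div]; rfl
  have hE : cdfE μ A B (((a + b) / 2 : ℝ) : EReal) = cdf μ A B ((a + b) / 2) := by
    simp only [cdfE, cdf, EReal.coe_le_coe_iff]; rfl
  rw [hm, hE, IsMed, le_cdf_iff_forall_gt hμ, cdfL, csSup_le_iff]
  · simp only [forall_mem_image, mem_ofPred_eq, EReal.coe_lt_coe_iff]
  · exact ⟨1, by rintro _ ⟨s, _, rfl⟩; exact cdf_le_one s⟩
  · exact ⟨_, mem_image_of_mem _ (EReal.coe_lt_coe_iff.2 (sub_one_lt _))⟩

/-! ### The two integral representations of the distance -/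

theorem setIntegral_eq_abs_sub {l r a b : ℝ} (ha : a ∈ Icc l r) (hb : b ∈ Icc l r) {φ : ℝ → ℝ}
    (hφ : ∀ s ∈ Ioc l r, s ≠ a → s ≠ b → φ s = (uIoc a b).indicator 1 s) :
    ∫ s in Ioc l r, φ s = |a - b| := by
  have hsub : uIoc a b ⊆ Ioc l r := Ioc_subset_Ioc (le_min ha.1 hb.1) (max_le ha.2 hb.2)
  have hae : ∀ c : ℝ, ∀ᵐ s : ℝ, s ≠ c := fun c => by simp [ae_iff]
  rw [setIntegral_congr_ae (g := (uIoc a b).indicator 1) measurableSet_Ioc,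
    integral_indicator_one measurableSet_uIoc, measureReal_restrict_apply measurableSet_uIoc,
    inter_eq_left.2 hsub, Measure.real, Real.volume_uIoc, ENNReal.toReal_ofReal (abs_nonneg _),
    abs_sub_comm]
  filter_upwards [hae a, hae b] with s h1 h2 hs using hφ s hs h1 h2

theorem integral_abs_quant_sub {A B : ℝ} (hAB : A ≤ B) {μ ν : Measure ℝ}
    [IsProbabilityMeasure μ] [IsProbabilityMeasure ν] :
    ∫ y in Ioo (0 : ℝ) 1, |quant μ A B y - quant ν A B y| =
      ∫ s in A..B, |cdf μ A B s - cdf ν A B s| := by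
  let S : Set (ℝ × ℝ) := {z | cdf μ A B z.2 ≤ z.1}
  let T : Set (ℝ × ℝ) := {z | cdf ν A B z.2 ≤ z.1}
  have hS : MeasurableSet S :=
    measurableSet_le (cdf_mono.measurable.comp measurable_snd) measurable_fst
  have hT : MeasurableSet T :=
    measurableSet_le (cdf_mono.measurable.comp measurable_snd) measurable_fst
  let f : ℝ → ℝ → ℝ := fun y s => (symmDiff S T).indicator 1 (y, s)
  have hf : Integrable (Function.uncurry f)
      ((volume.restrict (Ioc (0 : ℝ) 1)).prod (volume.restrict (Ioc A B))) :=
    (integrable_indicator_iff (hS.symmDiff hT)).2 (integrableOn_const (by finiteness) (by simp))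
  have key := integral_integral_swap hf
  rw [integral_Ioc_eq_integral_Ioo.symm, intervalIntegral.integral_of_le hAB]
  have e1 : ∀ y, ∫ s in Ioc A B, f y s = |quant μ A B y - quant ν A B y| := fun y => by
    refine setIntegral_eq_abs_sub (quant_mem hAB y) (quant_mem hAB y) fun s hs h1 h2 => ?_
    have hm : ∀ (ρ : Measure ℝ) [IsProbabilityMeasure ρ], s ≠ quant ρ A B y →
        (cdf ρ A B s ≤ y ↔ s < quant ρ A B y) := fun ρ _ h =>
      ⟨fun h' => lt_of_le_of_ne (le_quant ⟨hs.1.le, hs.2⟩ h') h, cdf_le_of_lt_quant hAB hs.1.le⟩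
    have : (y, s) ∈ symmDiff S T ↔ s ∈ uIoc (quant μ A B y) (quant ν A B y) := by
      simp only [mem_symmDiff, S, T, mem_ofPred_eq, hm μ h1, hm ν h2, mem_uIoc, not_lt]
      grind
    by_cases h : (y, s) ∈ symmDiff S T
    · simp [f, h, this.1 h]
    · simp [f, h, mt this.2 h]
  have e2 : ∀ s, ∫ y in Ioc (0 : ℝ) 1, f y s = |cdf μ A B s - cdf ν A B s| := fun s => by
    refine setIntegral_eq_abs_sub ⟨cdf_nonneg _ _ _ _, cdf_le_one _⟩
      ⟨cdf_nonneg _ _ _ _, cdf_le_one _⟩ fun y hy h1 h2 => ?_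
    have : (y, s) ∈ symmDiff S T ↔ y ∈ uIoc (cdf μ A B s) (cdf ν A B s) := by
      simp only [mem_symmDiff, S, T, mem_ofPred_eq, mem_uIoc, not_le]
      grind
    by_cases h : (y, s) ∈ symmDiff S T
    · simp [f, h, this.1 h]
    · simp [f, h, mt this.2 h]
  simp only [e1, e2] at key
  exact key

/-! ### Finitely supported measures -/

theorem psum_zero (n : ℕ) (p : Fin n → ℝ) : psum n p 0 = 0 := by simp [psum]

theorem psum_self (n : ℕ) (p : Fin n → ℝ) : psum n p n = ∑ j, p j := by simp [psum]

theorem psum_succ (n : ℕ) (p : Fin n → ℝ) (j : Fin n) :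
    psum n p ((j : ℕ) + 1) = psum n p j + p j := by
  have h : p j = ∑ i : Fin n, if i = j then p i else 0 := by simp
  rw [h, psum, psum, ← Finset.sum_add_distrib]
  refine Finset.sum_congr rfl fun i _ => ?_
  rcases lt_trichotomy i j with hij | rfl | hij
  · have : (i : ℕ) < j := hij
    simp [hij.ne, this, this.trans (Nat.lt_succ_self _)]
  · simp
  · have h1 : ¬ (i : ℕ) < j := not_lt.2 (le_of_lt (by exact_mod_cast hij))
    have h2 : ¬ (i : ℕ) < j + 1 := by have : (j : ℕ) < i := hij; omega
    simp [hij.ne', h1, h2]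

theorem psum_mono {n : ℕ} {p : Fin n → ℝ} (hp : IsPi n p) : Monotone (psum n p) := by
  intro i k hik
  refine Finset.sum_le_sum fun j _ => ?_
  have := hp.1 j
  split_ifs <;> first | rfl | assumption | omega

theorem exists_isPi_of_monotone {n : ℕ} {P : ℕ → ℝ} (hP : Monotone P) (h0 : P 0 = 0)
    (h1 : P n = 1) : ∃ p : Fin n → ℝ, IsPi n p ∧ ∀ i ≤ n, psum n p i = P i := by
  let p : Fin n → ℝ := fun j => P (j + 1) - P j
  have hsum : ∀ i ≤ n, psum n p i = P i := by
    intro i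
    induction i with
    | zero => intro _; rw [psum_zero, h0]
    | succ k ih =>
      intro hk
      have := psum_succ n p ⟨k, hk⟩
      simp only at this
      rw [this, ih (by omega)]
      simp [p]
  refine ⟨p, ⟨fun j => sub_nonneg.2 (hP (Nat.le_succ _)), ?_⟩, hsum⟩
  rw [← psum_self, hsum n le_rfl, h1]

theorem isProbabilityMeasure_discr {n : ℕ} {x p : Fin n → ℝ} (hp : IsPi n p) :
    IsProbabilityMeasure (discr n x p) := by
  constructor
  simp only [discr, Measure.coe_finsetSum, Finset.sum_apply, Measure.smul_apply, measure_univ,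
    smul_eq_mul, mul_one]
  rw [← ENNReal.ofReal_sum_of_nonneg fun j _ => hp.1 j, hp.2, ENNReal.ofReal_one]

theorem cdf_discr {A B : ℝ} {n : ℕ} {x p : Fin n → ℝ} (hx : IsXi A B n x) (hp : IsPi n p)
    (s : ℝ) : cdf (discr n x p) A B s = ∑ j, if x j ≤ s then p j else 0 := by
  have hm : MeasurableSet (Icc A B ∩ Iic s) := measurableSet_Icc.inter measurableSet_Iic
  simp only [cdf, discr, Measure.coe_finsetSum, Finset.sum_apply, Measure.smul_apply,
    Measure.dirac_apply' _ hm, smul_eq_mul]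
  rw [ENNReal.toReal_sum]
  · refine Finset.sum_congr rfl fun j _ => ?_
    have := hx.1 j
    by_cases h : x j ≤ s <;> simp [indicator, h, this.1, this.2, hp.1 j]
  · intro j _
    by_cases h : x j ∈ Icc A B ∩ Iic s <;> simp [indicator, h]

theorem quant_discr {A B : ℝ} {n : ℕ} {x p : Fin n → ℝ} (hx : IsXi A B n x) (hp : IsPi n p)
    {j : Fin n} {y : ℝ} (h1 : psum n p j ≤ y) (h2 : y < psum n p ((j : ℕ) + 1)) :
    quant (discr n x p) A B y = x j := by
  have := isProbabilityMeasure_discr (x := x) hp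
  refine quant_eq_of_cdf (hx.1 j) (fun s hs => le_trans ?_ h1) (h2.trans_le ?_)
  all_goals
    rw [cdf_discr hx hp, psum]
    refine Finset.sum_le_sum fun i _ => ?_
    have h0 := hp.1 i
  · by_cases h : x i ≤ s
    · have : i < j := by
        by_contra! hji
        linarith [hx.2 hji]
      have : (i : ℕ) < j := this
      simp [h, this]
    · simp only [h, if_false]; split_ifs <;> first | rfl | assumption
  · by_cases h : (i : ℕ) < j + 1
    · have : x i ≤ x j := hx.2 (by rw [Fin.le_def]; omega)
      simp [h, this]
    · simp only [h, if_false]; split_ifs <;> first | rfl | assumption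

/-- The locations `x`, extended by the endpoints of `[A,B]`. -/
def realPts (A B : ℝ) (n : ℕ) (x : Fin n → ℝ) (j : ℕ) : ℝ :=
  if j = 0 then A else if h : j - 1 < n then x ⟨j - 1, h⟩ else B

theorem realPts_mono {A B : ℝ} {n : ℕ} {x : Fin n → ℝ} (hAB : A ≤ B) (hx : IsXi A B n x) :
    Monotone (realPts A B n x) := by
  intro i k hik
  unfold realPts
  split_ifs
  any_goals omega
  · rfl
  · exact (hx.1 _).1
  · exact hx.2 (by rw [Fin.le_def]; exact Nat.sub_le_sub_right hik 1)
  · exact (hx.1 _).2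
  · rfl

theorem cdf_discr_eq_psum {A B : ℝ} {n : ℕ} {x p : Fin n → ℝ} (hx : IsXi A B n x)
    (hp : IsPi n p) {j : ℕ} (hj : j ≤ n) {s : ℝ} (h1 : realPts A B n x j < s)
    (h2 : s < realPts A B n x (j + 1)) : cdf (discr n x p) A B s = psum n p j := by
  rw [cdf_discr hx hp, psum]
  refine Finset.sum_congr rfl fun i _ => ?_
  congr 1
  refine propext ⟨fun h => ?_, fun h => ?_⟩
  · by_contra! hji
    have hjn : j < n := hji.trans_lt i.2
    have : x ⟨j, hjn⟩ ≤ x i := hx.2 hji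
    simp only [realPts, Nat.add_eq_zero_iff, one_ne_zero, and_false, if_false,
      Nat.add_sub_cancel, hjn, dite_true] at h2
    linarith
  · have hj0 : j ≠ 0 := by omega
    have hjn : j - 1 < n := by omega
    have : x i ≤ x ⟨j - 1, hjn⟩ := hx.2 (by rw [Fin.le_def]; simp only; omega)
    simp only [realPts, hj0, if_false, hjn, dite_true] at h1
    linarith

theorem dKant1_discr_eq_sum_quant {A B : ℝ} (hAB : A ≤ B) {μ : Measure ℝ}
    [IsProbabilityMeasure μ] {n : ℕ} {x p : Fin n → ℝ} (hx : IsXi A B n x) (hp : IsPi n p) :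
    dKant1 A B μ (discr n x p) = (B - A)⁻¹ * ∑ j : Fin n,
      ∫ y in psum n p j..psum n p ((j : ℕ) + 1), |quant μ A B y - x j| := by
  have := isProbabilityMeasure_discr (x := x) hp
  have hi : ∀ u v, IntervalIntegrable
      (fun y => |quant μ A B y - quant (discr n x p) A B y|) volume u v := fun u v =>
    ((quant_mono hAB).intervalIntegrable.sub (quant_mono hAB).intervalIntegrable).abs
  rw [dKant1, ← integral_Ioc_eq_integral_Ioo, ← intervalIntegral.integral_of_le zero_le_one]
  have h := intervalIntegral.sum_integral_adjacent_intervals (a := psum n p) (n := n)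
    fun k _ => hi (psum n p k) (psum n p (k + 1))
  rw [psum_zero, psum_self, hp.2] at h
  rw [← h, Finset.sum_range]
  congr 1
  refine Finset.sum_congr rfl fun j _ => intervalIntegral.integral_congr_ae ?_
  have hae : ∀ᵐ y : ℝ, y ≠ psum n p ((j : ℕ) + 1) := by simp [ae_iff]
  filter_upwards [hae] with y hy hm
  rw [uIoc_of_le (psum_mono hp (Nat.le_succ _))] at hm
  rw [quant_discr hx hp hm.1.le (lt_of_le_of_ne hm.2 hy)]

theorem dKant1_discr_eq_sum_cdf {A B : ℝ} (hAB : A ≤ B) {μ : Measure ℝ}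
    [IsProbabilityMeasure μ] {n : ℕ} {x p : Fin n → ℝ} (hx : IsXi A B n x) (hp : IsPi n p) :
    dKant1 A B μ (discr n x p) = (B - A)⁻¹ * ∑ j ∈ Finset.range (n + 1),
      ∫ s in realPts A B n x j..realPts A B n x (j + 1), |cdf μ A B s - psum n p j| := by
  have := isProbabilityMeasure_discr (x := x) hp
  have hi : ∀ u v, IntervalIntegrable
      (fun y => |cdf μ A B y - cdf (discr n x p) A B y|) volume u v := fun u v =>
    (cdf_mono.intervalIntegrable.sub cdf_mono.intervalIntegrable).abs
  rw [dKant1, integral_abs_quant_sub hAB]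
  have h := intervalIntegral.sum_integral_adjacent_intervals (a := realPts A B n x) (n := n + 1)
    fun k _ => hi (realPts A B n x k) (realPts A B n x (k + 1))
  have h0 : realPts A B n x 0 = A := by simp [realPts]
  have h1 : realPts A B n x (n + 1) = B := by simp [realPts]
  rw [h0, h1] at h
  rw [← h]
  congr 1
  refine Finset.sum_congr rfl fun j hj => intervalIntegral.integral_congr_ae ?_
  have hae : ∀ᵐ y : ℝ, y ≠ realPts A B n x (j + 1) := by simp [ae_iff]
  filter_upwards [hae] with y hy hm
  rw [uIoc_of_le (realPts_mono hAB hx (Nat.le_succ _))] at hm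
  rw [cdf_discr_eq_psum hx hp (Nat.lt_succ_iff.1 (Finset.mem_range.1 hj)) hm.1
    (lt_of_le_of_ne hm.2 hy)]

/-! ### Best approximations -/

theorem isMed_midpoint {G : ℝ → ℝ} (hG : Monotone G) (a b : ℝ) :
    IsMed G a b (G ((a + b) / 2)) := ⟨fun _ hs => hG hs.le, fun _ hs => hG (le_of_lt hs)⟩

theorem le_of_sum_le_sum_of_le {ι : Type*} {s : Finset ι} {f g : ι → ℝ}
    (h : ∑ i ∈ s, f i ≤ ∑ i ∈ s, g i) (hle : ∀ i ∈ s, g i ≤ f i) : ∀ i ∈ s, f i ≤ g i :=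
  fun i hi => ((Finset.sum_eq_sum_iff_of_le hle).1 ((Finset.sum_le_sum hle).antisymm h) i hi).ge

theorem extPts_eq_realPts {A B : ℝ} {n : ℕ} {x : Fin n → ℝ} {j : ℕ} (h0 : 0 < j) (hj : j ≤ n) :
    extPts n x j = (realPts A B n x j : EReal) := by
  have : j - 1 < n := by omega
  simp [extPts, realPts, h0.ne', hj, this]

/-- The optimality conditions for prescribed locations are vacuous for `j = 0` and `j = n`, and
express that `P_j` is a median of `F_μ` on `[x_j, x_{j+1}]` otherwise. -/
theorem location_condition_iff {A B : ℝ} {μ : Measure ℝ} [IsProbabilityMeasure μ]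
    (hμ : μ (Icc A B) = 1) {n : ℕ} {x p : Fin n → ℝ} (hp : IsPi n p) {j : ℕ} (hj : j ≤ n) :
    (extPts n x j < extPts n x (j + 1) →
      cdfL μ A B ((extPts n x j + extPts n x (j + 1)) / 2) ≤ psum n p j ∧
        psum n p j ≤ cdfE μ A B ((extPts n x j + extPts n x (j + 1)) / 2)) ↔
    (0 < j → j < n → realPts A B n x j < realPts A B n x (j + 1) →
      IsMed (cdf μ A B) (realPts A B n x j) (realPts A B n x (j + 1)) (psum n p j)) := by
  rcases Nat.eq_zero_or_pos j with rfl | h0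
  · refine iff_of_true (fun _ => ?_) fun h => absurd h (lt_irrefl _)
    have : extPts n x 0 = ⊥ := by simp [extPts]
    rw [this, EReal.bot_add, EReal.bot_div_of_pos_ne_top (by norm_num) (by decide), psum_zero]
    exact ⟨by simp [cdfL], ENNReal.toReal_nonneg⟩
  rcases hj.eq_or_lt with rfl | hjn
  · refine iff_of_true (fun _ => ?_) fun _ h => absurd h (lt_irrefl _)
    have : extPts j x (j + 1) = ⊤ := by simp [extPts]
    rw [this, extPts_eq_realPts (A := A) (B := B) h0 le_rfl, EReal.coe_add_top,
      EReal.top_div_of_pos_ne_top (by norm_num) (by decide), psum_self, hp.2]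
    refine ⟨csSup_le ⟨_, mem_image_of_mem _ (EReal.coe_lt_top 0)⟩ ?_, ?_⟩
    · rintro _ ⟨s, _, rfl⟩; exact cdf_le_one s
    · simp [cdfE, hμ]
  · rw [extPts_eq_realPts (A := A) (B := B) h0 hj,
      extPts_eq_realPts (A := A) (B := B) (Nat.succ_pos j) hjn, EReal.coe_lt_coe_iff,
      isMed_cdf_iff hμ]
    exact ⟨fun h _ _ => h, fun h => h h0 hjn⟩

section Optimality

variable {A B : ℝ} {μ : Measure ℝ} [IsProbabilityMeasure μ] {n : ℕ}

/-- Some probability vector is optimal for each of the pieces into which the locations `x`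
divide `[A,B]`. -/
theorem exists_best_weights (hAB : A ≤ B) (hn : 0 < n) {x : Fin n → ℝ} (hx : IsXi A B n x) :
    ∃ p : Fin n → ℝ, IsPi n p ∧ ∀ j, 0 < j → j < n →
      IsMed (cdf μ A B) (realPts A B n x j) (realPts A B n x (j + 1)) (psum n p j) := by
  have hX := realPts_mono hAB hx
  let P : ℕ → ℝ := fun j => if j = 0 then 0 else if j < n then
    cdf μ A B ((realPts A B n x j + realPts A B n x (j + 1)) / 2) else 1
  have hP : Monotone P := by
    refine monotone_nat_of_le_succ fun j => ?_
    simp only [P, Nat.succ_ne_zero, if_false]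
    split_ifs
    any_goals omega
    · exact cdf_nonneg _ _ _ _
    · exact zero_le_one
    · exact cdf_mono (by linarith [hX (Nat.le_succ j), hX (Nat.le_succ (j + 1))])
    · exact cdf_le_one _
    · rfl
  obtain ⟨p, hp, hpP⟩ := exists_isPi_of_monotone hP (n := n) (by simp [P]) (by simp [P, hn.ne'])
  refine ⟨p, hp, fun j h0 hj => ?_⟩
  rw [hpP j hj.le]
  simp only [P, h0.ne', hj, if_false, if_true]
  exact isMed_midpoint cdf_mono _ _

/-- Weights that satisfy the median condition are optimal on every piece. -/
theorem integral_cdf_le_of_isMed (hAB : A ≤ B) {x p q : Fin n → ℝ} (hx : IsXi A B n x)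
    (hp : IsPi n p) (hq : IsPi n q) {j : ℕ} (hj : j ≤ n)
    (h : 0 < j → j < n → realPts A B n x j < realPts A B n x (j + 1) →
      IsMed (cdf μ A B) (realPts A B n x j) (realPts A B n x (j + 1)) (psum n p j)) :
    ∫ s in realPts A B n x j..realPts A B n x (j + 1), |cdf μ A B s - psum n p j| ≤
      ∫ s in realPts A B n x j..realPts A B n x (j + 1), |cdf μ A B s - psum n q j| := by
  rcases Nat.eq_zero_or_pos j with rfl | h0
  · rw [psum_zero, psum_zero]
  rcases hj.eq_or_lt with rfl | hjn
  · rw [psum_self, psum_self, hp.2, hq.2]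
  rcases (realPts_mono hAB hx (Nat.le_succ j)).eq_or_lt with he | hlt
  · rw [Nat.succ_eq_add_one] at he
    rw [he, intervalIntegral.integral_same, intervalIntegral.integral_same]
  · exact (h h0 hjn hlt).integral_le cdf_mono hlt.le _

theorem best_weights_of_isMed (hAB : A ≤ B) {x p : Fin n → ℝ} (hx : IsXi A B n x)
    (hp : IsPi n p)
    (h : ∀ j, 0 < j → j < n → realPts A B n x j < realPts A B n x (j + 1) →
      IsMed (cdf μ A B) (realPts A B n x j) (realPts A B n x (j + 1)) (psum n p j))
    {q : Fin n → ℝ} (hq : IsPi n q) :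
    dKant1 A B μ (discr n x p) ≤ dKant1 A B μ (discr n x q) := by
  rw [dKant1_discr_eq_sum_cdf hAB hx hp, dKant1_discr_eq_sum_cdf hAB hx hq]
  refine mul_le_mul_of_nonneg_left (Finset.sum_le_sum fun j hj => ?_)
    (inv_nonneg.2 (sub_nonneg.2 hAB))
  exact integral_cdf_le_of_isMed hAB hx hp hq (Nat.lt_succ_iff.1 (Finset.mem_range.1 hj)) (h j)

theorem isMed_of_best_weights (hAB : A < B) (hn : 0 < n) {x p : Fin n → ℝ} (hx : IsXi A B n x)
    (hp : IsPi n p) (h : ∀ q : Fin n → ℝ, IsPi n q →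
      dKant1 A B μ (discr n x p) ≤ dKant1 A B μ (discr n x q))
    {j : ℕ} (h0 : 0 < j) (hj : j < n) (hlt : realPts A B n x j < realPts A B n x (j + 1)) :
    IsMed (cdf μ A B) (realPts A B n x j) (realPts A B n x (j + 1)) (psum n p j) := by
  obtain ⟨q, hq, hmed⟩ := exists_best_weights (μ := μ) hAB.le hn hx
  have hle := h q hq
  rw [dKant1_discr_eq_sum_cdf hAB.le hx hp, dKant1_discr_eq_sum_cdf hAB.le hx hq] at hle
  have hle' := le_of_mul_le_mul_left hle (inv_pos.2 (sub_pos.2 hAB))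
  exact (hmed j h0 hj).of_integral_le cdf_mono hlt (le_of_sum_le_sum_of_le hle'
    (fun i hi => integral_cdf_le_of_isMed hAB.le hx hq hp
      (Nat.lt_succ_iff.1 (Finset.mem_range.1 hi)) fun h0 hi _ => hmed i h0 hi)
    j (Finset.mem_range.2 (by omega)))

/-- Some vector of locations is optimal for each of the pieces into which the weights `p`
divide `[0,1]`. -/
theorem exists_best_locations (hAB : A ≤ B) {p : Fin n → ℝ} (hp : IsPi n p) :
    ∃ x : Fin n → ℝ, IsXi A B n x ∧ ∀ j : Fin n,
      IsMed (quant μ A B) (psum n p j) (psum n p ((j : ℕ) + 1)) (x j) := by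
  refine ⟨fun j => quant μ A B ((psum n p j + psum n p ((j : ℕ) + 1)) / 2),
    ⟨fun j => quant_mem hAB _, fun i k hik => quant_mono hAB ?_⟩,
    fun j => isMed_midpoint (quant_mono hAB) _ _⟩
  have h1 := psum_mono hp (Fin.le_def.1 hik)
  have h2 := psum_mono hp (Nat.succ_le_succ (Fin.le_def.1 hik))
  simp only [Nat.succ_eq_add_one] at h2
  linarith

theorem integral_quant_le_of_isMed (hAB : A ≤ B) {p : Fin n → ℝ} (hp : IsPi n p) {j : Fin n}
    {c : ℝ} (h : psum n p j < psum n p ((j : ℕ) + 1) →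
      IsMed (quant μ A B) (psum n p j) (psum n p ((j : ℕ) + 1)) c) (d : ℝ) :
    ∫ y in psum n p j..psum n p ((j : ℕ) + 1), |quant μ A B y - c| ≤
      ∫ y in psum n p j..psum n p ((j : ℕ) + 1), |quant μ A B y - d| := by
  rcases (psum_mono hp (Nat.le_succ j)).eq_or_lt with he | hlt
  · rw [Nat.succ_eq_add_one] at he
    rw [he, intervalIntegral.integral_same, intervalIntegral.integral_same]
  · exact (h hlt).integral_le (quant_mono hAB) hlt.le _

theorem best_locations_of_isMed (hAB : A ≤ B) {x p : Fin n → ℝ} (hx : IsXi A B n x)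
    (hp : IsPi n p)
    (h : ∀ j : Fin n, psum n p j < psum n p ((j : ℕ) + 1) →
      IsMed (quant μ A B) (psum n p j) (psum n p ((j : ℕ) + 1)) (x j))
    {y : Fin n → ℝ} (hy : IsXi A B n y) :
    dKant1 A B μ (discr n x p) ≤ dKant1 A B μ (discr n y p) := by
  rw [dKant1_discr_eq_sum_quant hAB hx hp, dKant1_discr_eq_sum_quant hAB hy hp]
  exact mul_le_mul_of_nonneg_left
    (Finset.sum_le_sum fun j _ => integral_quant_le_of_isMed hAB hp (h j) _)
    (inv_nonneg.2 (sub_nonneg.2 hAB))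

theorem isMed_of_best_locations (hAB : A < B) {x p : Fin n → ℝ} (hx : IsXi A B n x)
    (hp : IsPi n p) (h : ∀ y : Fin n → ℝ, IsXi A B n y →
      dKant1 A B μ (discr n x p) ≤ dKant1 A B μ (discr n y p))
    {j : Fin n} (hlt : psum n p j < psum n p ((j : ℕ) + 1)) :
    IsMed (quant μ A B) (psum n p j) (psum n p ((j : ℕ) + 1)) (x j) := by
  obtain ⟨y, hy, hmed⟩ := exists_best_locations (μ := μ) hAB.le hp
  have hle := h y hy
  rw [dKant1_discr_eq_sum_quant hAB.le hx hp, dKant1_discr_eq_sum_quant hAB.le hy hp] at hle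
  have hle' := le_of_mul_le_mul_left hle (inv_pos.2 (sub_pos.2 hAB))
  exact (hmed j).of_integral_le (quant_mono hAB.le) hlt (le_of_sum_le_sum_of_le hle'
    (fun i _ => integral_quant_le_of_isMed hAB.le hp (fun _ => hmed i) _) j (Finset.mem_univ j))

theorem continuous_integral_abs_sub {G : ℝ → ℝ} (hG : Monotone G) :
    Continuous fun z : ℝ × ℝ => ∫ s in (0 : ℝ)..z.2, |G s - z.1| := by
  rw [continuous_iff_continuousAt]
  rintro ⟨c, t⟩
  refine intervalIntegral.continuousAt_parametric_primitive_of_dominated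
    (F := fun c s => |G s - c|) (fun s => |G s| + (|c| + 1)) (min 0 t - 1) (max 0 t + 1)
    (fun d => ?_) ?_ ?_ ?_ ?_ ?_ (measure_singleton t)
  · exact (hG.measurable.sub_const d).abs.aestronglyMeasurable
  · filter_upwards [Metric.ball_mem_nhds c one_pos] with d hd
    refine ae_of_all _ fun s => ?_
    rw [Real.norm_eq_abs, abs_abs]
    rw [Metric.mem_ball, Real.dist_eq] at hd
    have h1 := abs_sub (G s) d
    have h2 := abs_sub_abs_le_abs_sub d c
    linarith
  · exact hG.intervalIntegrable.abs.add intervalIntegrable_const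
  · exact ae_of_all _ fun s => (by fun_prop : Continuous fun c : ℝ => |G s - c|).continuousAt
  · exact ⟨by linarith [min_le_left 0 t], by linarith [le_max_left 0 t]⟩
  · exact ⟨by linarith [min_le_right 0 t], by linarith [le_max_right 0 t]⟩

theorem continuous_psum (n i : ℕ) : Continuous fun p : Fin n → ℝ => psum n p i := by
  unfold psum
  refine continuous_finsetSum _ fun j _ => ?_
  split_ifs <;> fun_prop

theorem exists_best_approximation (hAB : A ≤ B) (hn : 0 < n) :
    ∃ x p : Fin n → ℝ, IsXi A B n x ∧ IsPi n p ∧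
      ∀ y q : Fin n → ℝ, IsXi A B n y → IsPi n q →
        dKant1 A B μ (discr n x p) ≤ dKant1 A B μ (discr n y q) := by
  have hXi : IsCompact {x : Fin n → ℝ | IsXi A B n x} := by
    have : {x : Fin n → ℝ | IsXi A B n x} = (univ.pi fun _ => Icc A B) ∩ {x | Monotone x} := by
      ext x; simp only [IsXi, mem_ofPred_eq, mem_inter_iff, mem_univ_pi]
    rw [this]
    exact (isCompact_univ_pi fun _ => isCompact_Icc).inter_right isClosed_monotone
  have hPi : IsCompact {p : Fin n → ℝ | IsPi n p} := isCompact_stdSimplex ℝ (Fin n)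
  have hne : ({x : Fin n → ℝ | IsXi A B n x} ×ˢ {p : Fin n → ℝ | IsPi n p}).Nonempty :=
    ⟨(fun _ => A, Pi.single ⟨0, hn⟩ 1), ⟨fun _ => ⟨le_rfl, hAB⟩, fun _ _ _ => le_rfl⟩,
      single_mem_stdSimplex ℝ _⟩
  let Φ : ℝ × ℝ → ℝ := fun z => ∫ s in (0 : ℝ)..z.2, |quant μ A B s - z.1|
  have hΦ : Continuous Φ := continuous_integral_abs_sub (quant_mono hAB)
  have hcont : Continuous fun z : (Fin n → ℝ) × (Fin n → ℝ) => (B - A)⁻¹ * ∑ j : Fin n,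
      (Φ (z.1 j, psum n z.2 ((j : ℕ) + 1)) - Φ (z.1 j, psum n z.2 j)) := by
    refine continuous_const.mul (continuous_finsetSum _ fun j _ => ?_)
    have hj : Continuous fun z : (Fin n → ℝ) × (Fin n → ℝ) => z.1 j := by fun_prop
    exact (hΦ.comp (hj.prodMk ((continuous_psum n _).comp continuous_snd))).sub
      (hΦ.comp (hj.prodMk ((continuous_psum n _).comp continuous_snd)))
  have heq : ∀ x p, IsXi A B n x → IsPi n p → dKant1 A B μ (discr n x p) =
      (B - A)⁻¹ * ∑ j : Fin n,
        (Φ (x j, psum n p ((j : ℕ) + 1)) - Φ (x j, psum n p j)) := fun x p hx hp => by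
    rw [dKant1_discr_eq_sum_quant hAB hx hp]
    congr 1
    refine Finset.sum_congr rfl fun j _ => ?_
    exact (intervalIntegral.integral_interval_sub_left
      (intervalIntegrable_abs_sub (quant_mono hAB) _ _ _)
      (intervalIntegrable_abs_sub (quant_mono hAB) _ _ _)).symm
  obtain ⟨⟨x, p⟩, ⟨hx, hp⟩, hmin⟩ := (hXi.prod hPi).exists_isMinOn hne hcont.continuousOn
  refine ⟨x, p, hx, hp, fun y q hy hq => ?_⟩
  rw [heq x p hx hp, heq y q hy hq]
  exact isMinOn_iff.1 hmin (y, q) ⟨hy, hq⟩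

end Optimality


/-- Prop. 4.1: best `d_1`-approximations with prescribed locations (i),
prescribed weights (ii), and necessary optimality conditions in the unconstrained case (iii). -/
theorem best_dKant1 (A B : ℝ) (hAB : A < B) (μ : Measure ℝ) [IsProbabilityMeasure μ]
    (hμ : μ (Icc A B) = 1) (n : ℕ) (hn : 0 < n) :
    -- (i) prescribed locations
    (∀ x : Fin n → ℝ, IsXi A B n x →
      (∃ p : Fin n → ℝ, IsPi n p ∧ ∀ q : Fin n → ℝ, IsPi n q →
        dKant1 A B μ (discr n x p) ≤ dKant1 A B μ (discr n x q)) ∧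
      (∀ p : Fin n → ℝ, IsPi n p →
        ((∀ q : Fin n → ℝ, IsPi n q →
            dKant1 A B μ (discr n x p) ≤ dKant1 A B μ (discr n x q)) ↔
          (∀ j : ℕ, j ≤ n → extPts n x j < extPts n x (j + 1) →
            cdfL μ A B ((extPts n x j + extPts n x (j + 1)) / 2) ≤ psum n p j ∧
              psum n p j ≤ cdfE μ A B ((extPts n x j + extPts n x (j + 1)) / 2))))) ∧
    -- (ii) prescribed weights
    (∀ p : Fin n → ℝ, IsPi n p →
      (∃ x : Fin n → ℝ, IsXi A B n x ∧ ∀ y : Fin n → ℝ, IsXi A B n y →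
        dKant1 A B μ (discr n x p) ≤ dKant1 A B μ (discr n y p)) ∧
      (∀ x : Fin n → ℝ, IsXi A B n x →
        ((∀ y : Fin n → ℝ, IsXi A B n y →
            dKant1 A B μ (discr n x p) ≤ dKant1 A B μ (discr n y p)) ↔
          (∀ j : Fin n, psum n p (j : ℕ) < psum n p ((j : ℕ) + 1) →
            quantm μ A B ((psum n p (j : ℕ) + psum n p ((j : ℕ) + 1)) / 2) ≤ x j ∧
              x j ≤ quant μ A B ((psum n p (j : ℕ) + psum n p ((j : ℕ) + 1)) / 2))))) ∧
    -- (iii) unconstrained: existence and necessary conditions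
    ((∃ x p : Fin n → ℝ, IsXi A B n x ∧ IsPi n p ∧
        ∀ y q : Fin n → ℝ, IsXi A B n y → IsPi n q →
          dKant1 A B μ (discr n x p) ≤ dKant1 A B μ (discr n y q)) ∧
      ∀ x p : Fin n → ℝ, IsXi A B n x → IsPi n p →
        (∀ y q : Fin n → ℝ, IsXi A B n y → IsPi n q →
          dKant1 A B μ (discr n x p) ≤ dKant1 A B μ (discr n y q)) →
        (∀ j : ℕ, 1 ≤ j → j ≤ n →
          (extPts n x j < extPts n x (j + 1) →
            cdfL μ A B ((extPts n x j + extPts n x (j + 1)) / 2) ≤ psum n p j ∧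
              psum n p j ≤ cdfE μ A B ((extPts n x j + extPts n x (j + 1)) / 2))) ∧
        (∀ j : Fin n, psum n p (j : ℕ) < psum n p ((j : ℕ) + 1) →
          quantm μ A B ((psum n p (j : ℕ) + psum n p ((j : ℕ) + 1)) / 2) ≤ x j ∧
            x j ≤ quant μ A B ((psum n p (j : ℕ) + psum n p ((j : ℕ) + 1)) / 2))) := by

  have hloc : ∀ x : Fin n → ℝ, IsXi A B n x → ∀ p : Fin n → ℝ, IsPi n p →
      ((∀ q : Fin n → ℝ, IsPi n q →
          dKant1 A B μ (discr n x p) ≤ dKant1 A B μ (discr n x q)) ↔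
        (∀ j : ℕ, j ≤ n → extPts n x j < extPts n x (j + 1) →
          cdfL μ A B ((extPts n x j + extPts n x (j + 1)) / 2) ≤ psum n p j ∧
            psum n p j ≤ cdfE μ A B ((extPts n x j + extPts n x (j + 1)) / 2))) :=
    fun x hx p hp =>
      ⟨fun h j hj => (location_condition_iff hμ hp hj).2 fun h0 hjn =>
          isMed_of_best_weights hAB hn hx hp h h0 hjn,
        fun h q hq => best_weights_of_isMed hAB.le hx hp (fun j h0 hjn =>
          (location_condition_iff hμ hp hjn.le).1 (h j hjn.le) h0 hjn) hq⟩
  have hwt : ∀ p : Fin n → ℝ, IsPi n p → ∀ x : Fin n → ℝ, IsXi A B n x →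
      ((∀ y : Fin n → ℝ, IsXi A B n y →
          dKant1 A B μ (discr n x p) ≤ dKant1 A B μ (discr n y p)) ↔
        (∀ j : Fin n, psum n p (j : ℕ) < psum n p ((j : ℕ) + 1) →
          quantm μ A B ((psum n p (j : ℕ) + psum n p ((j : ℕ) + 1)) / 2) ≤ x j ∧
            x j ≤ quant μ A B ((psum n p (j : ℕ) + psum n p ((j : ℕ) + 1)) / 2))) := by
    intro p hp x hx
    simp only [← isMed_quant_iff hAB.le]
    exact ⟨fun h j hj => isMed_of_best_locations hAB hx hp h hj,
      fun h y hy => best_locations_of_isMed hAB.le hx hp h hy⟩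
  refine ⟨fun x hx => ⟨?_, hloc x hx⟩, fun p hp => ⟨?_, hwt p hp⟩,
    exists_best_approximation hAB.le hn, fun x p hx hp h => ⟨?_, ?_⟩⟩
  · obtain ⟨p, hp, hmed⟩ := exists_best_weights (μ := μ) hAB.le hn hx
    exact ⟨p, hp, fun q hq =>
      best_weights_of_isMed hAB.le hx hp (fun j h0 hj _ => hmed j h0 hj) hq⟩
  · obtain ⟨x, hx, hmed⟩ := exists_best_locations (μ := μ) hAB.le hp
    exact ⟨x, hx, fun y hy => best_locations_of_isMed hAB.le hx hp (fun j _ => hmed j) hy⟩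
  · exact fun j _ hj => (hloc x hx p hp).1 (fun q hq => h x q hx hq) j hj
  · exact (hwt p hp x hx).1 fun y hy => h y p hy hp

end BenfordApprox
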